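/- Convex projection lemma: Let X be a Banach space, f : W → X Schwartz, T a tree, and A a finite convex set of tritiles with top 𝐏_T ∈ A. Then there exists g : W → X Schwartz, supported on I_T, such that ⟨g; w_{𝐏_u}⟩ = ⟨f; w_{𝐏_u}⟩ for all 𝐏 ∈ T ∩ A and u ∈ {0,1,2}, and ‖g‖_{L^∞(I_T;X)} ≲ sup_{𝐏 ∈ A ∩ T, u} ‖⟨f; w_{𝐏_u}⟩‖_X. -/

import Mathlib

open scoped ENNReal NNReal Classical

noncomputable section


/-- The ternary digit of a nonnegative real number `x` at position `m`. -/
def tdig (m : ℤ) (x : ℝ) : ℕ := (Int.floor (x * (3:ℝ) ^ (-m)) % 3).toNat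

/-- A primitive cube root of unity. -/
def om3 : ℂ := Complex.exp (2 * Real.pi * Complex.I / 3)

/-- The Walsh character `exp_ξ(x) = ω^{Σ_{j+k=−1} [ξ]_j [x]_k}`. -/
def wexp (xi x : ℝ) : ℂ := om3 ^ (∑ᶠ m : ℤ, tdig m xi * tdig (-1 - m) x)

/-- A tile `I × ω` of area 1 in the Walsh phase plane `[0,∞) × [0,∞)`, where
`I = [i·3^n, (i+1)·3^n)` and `ω = [j·3^(−n), (j+1)·3^(−n))`. -/
structure Tile where
  n : ℤ
  i : ℕ
  j : ℕ

namespace Tile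

/-- The time interval of a tile. -/
def I (P : Tile) : Set ℝ :=
  Set.Ico ((P.i : ℝ) * (3:ℝ) ^ P.n) (((P.i : ℝ) + 1) * (3:ℝ) ^ P.n)

/-- The frequency interval of a tile. -/
def freqI (P : Tile) : Set ℝ :=
  Set.Ico ((P.j : ℝ) * (3:ℝ) ^ (-P.n)) (((P.j : ℝ) + 1) * (3:ℝ) ^ (-P.n))

/-- The canonical frequency of a tile. -/
def freq (P : Tile) : ℝ := (P.j : ℝ) * (3:ℝ) ^ (-P.n)

/-- The tile, as a rectangle in the phase plane. -/
def rect (P : Tile) : Set (ℝ × ℝ) := P.I ×ˢ P.freqI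

end Tile

/-- The Walsh wave packet associated with a tile:
`w_P = |I_P|⁻¹ · exp_{ξ_P} · 1_{I_P}`. -/
def wp (P : Tile) : ℝ → ℂ :=
  fun x => if x ∈ P.I then (3:ℂ) ^ (-P.n) * wexp P.freq x else 0

/-- A tritile: a rectangle `I × ω` of area 3 with triadic sides,
`I = [i·3^n, (i+1)·3^n)`, `ω = [j·3^(1−n), (j+1)·3^(1−n))`. -/
structure Tritile where
  n : ℤ
  i : ℕ
  j : ℕ

namespace Tritile

/-- The time interval of a tritile. -/
def I (P : Tritile) : Set ℝ :=
  Set.Ico ((P.i : ℝ) * (3:ℝ) ^ P.n) (((P.i : ℝ) + 1) * (3:ℝ) ^ P.n)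

/-- The frequency interval of a tritile. -/
def freqI (P : Tritile) : Set ℝ :=
  Set.Ico ((P.j : ℝ) * (3:ℝ) ^ (1 - P.n)) (((P.j : ℝ) + 1) * (3:ℝ) ^ (1 - P.n))

/-- The tritile, as a rectangle in the phase plane. -/
def rect (P : Tritile) : Set (ℝ × ℝ) := P.I ×ˢ P.freqI

/-- The three horizontal subtiles `𝐏_u` of a tritile `𝐏`. -/
def sub (P : Tritile) (u : Fin 3) : Tile := ⟨P.n, P.i, 3 * P.j + u.val⟩

end Tritile

/-- A Walsh–Schwartz function: supported on `[0, 3^N)` and constant on every triadic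
interval of length `3^(−N)`, for some `N`. -/
def WalshSchwartz {X : Type*} [NormedAddCommGroup X] (f : ℝ → X) : Prop :=
  ∃ N : ℕ, (∀ x : ℝ, x ∉ Set.Ico (0:ℝ) ((3:ℝ) ^ (N:ℤ)) → f x = 0) ∧
    ∀ k : ℕ, ∀ x ∈ Set.Ico ((k:ℝ) * (3:ℝ) ^ (-(N:ℤ))) (((k:ℝ) + 1) * (3:ℝ) ^ (-(N:ℤ))),
      ∀ y ∈ Set.Ico ((k:ℝ) * (3:ℝ) ^ (-(N:ℤ))) (((k:ℝ) + 1) * (3:ℝ) ^ (-(N:ℤ))), f x = f y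

/-- The wave packet embedding `E[f](P) = ⟨f; w_P⟩ = ∫ f(x) w_P(x) dx` of an
`X`-valued function. -/
def emb {X : Type*} [NormedAddCommGroup X] [NormedSpace ℂ X] (f : ℝ → X) (P : Tile) : X :=
  ∫ x, wp P x • f x

/-- The tritile order: `Q ≤ P` iff `I_Q ⊆ I_P` and `ω_Q ⊇ ω_P`. -/
def tle (Q P : Tritile) : Prop := Q.I ⊆ P.I ∧ P.freqI ⊆ Q.freqI

/-- The tree with top `P`: all tritiles `≤ P`. -/
def tree (P : Tritile) : Set Tritile := {Q | tle Q P}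

/-- A set `A` of tritiles is convex if `P, P' ∈ A` and `P ≤ Q ≤ P'` imply `Q ∈ A`. -/
def TriConvex (A : Set Tritile) : Prop :=
  ∀ P P' Q : Tritile, P ∈ A → P' ∈ A → tle P Q → tle Q P' → Q ∈ A

open MeasureTheory

def tfl (n : ℤ) (x : ℝ) : ℤ := ⌊x * (3:ℝ) ^ (-n)⌋

lemma tfl_add (n : ℤ) (d : ℕ) (x : ℝ) : tfl (n + d) x = tfl n x / 3 ^ d := by
  unfold tfl
  have h : x * (3:ℝ) ^ (-(n + d)) = (x * (3:ℝ) ^ (-n)) / ((3 ^ d : ℕ) : ℝ) := by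
    rw [neg_add, zpow_add₀ (by norm_num), zpow_neg _ (d : ℤ), zpow_natCast]
    push_cast
    rw [div_eq_mul_inv]; ring
  rw [h, Int.floor_div_natCast]
  push_cast
  rfl

lemma tfl_pred (n : ℤ) (x : ℝ) : tfl n x = tfl (n - 1) x / 3 := by
  have := tfl_add (n - 1) 1 x
  simpa using this

lemma mem_tri (n : ℤ) (i : ℕ) (x : ℝ) :
    x ∈ Set.Ico ((i : ℝ) * (3:ℝ) ^ n) (((i : ℝ) + 1) * (3:ℝ) ^ n) ↔ tfl n x = i := by
  have h3 : (0:ℝ) < (3:ℝ) ^ n := by positivity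
  rw [tfl, Int.floor_eq_iff, zpow_neg, ← div_eq_mul_inv, le_div_iff₀ h3, div_lt_iff₀ h3]
  simp

lemma tfl_freq (n : ℤ) (j d : ℕ) : tfl (-n + d) ((j : ℝ) * (3:ℝ) ^ (-n)) = ((j / 3 ^ d : ℕ) : ℤ) := by
  have h : tfl (-n) ((j : ℝ) * (3:ℝ) ^ (-n)) = j := by
    rw [← mem_tri]
    have h3 : (0:ℝ) < (3:ℝ) ^ (-n) := by positivity
    constructor
    · exact le_rfl
    · nlinarith
  rw [tfl_add, h]; push_cast; rfl

lemma tdig_eq (m : ℤ) (x : ℝ) : tdig m x = (tfl m x % 3).toNat := rfl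

lemma tdig_freq (n : ℤ) (j d : ℕ) : tdig (-n + d) ((j : ℝ) * (3:ℝ) ^ (-n)) = (j / 3 ^ d) % 3 := by
  rw [tdig_eq, tfl_freq]; omega

lemma tdig_freq_low (n : ℤ) (j : ℕ) (m : ℤ) (h : m < -n) : tdig m ((j : ℝ) * (3:ℝ) ^ (-n)) = 0 := by
  obtain ⟨d, hd⟩ : ∃ d : ℕ, -n = m + 1 + d := ⟨(-n - m - 1).toNat, by omega⟩
  have : tfl m ((j : ℝ) * (3:ℝ) ^ (-n)) = (j * 3 ^ d : ℤ) * 3 := by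
    unfold tfl
    rw [Int.floor_eq_iff]
    have e : (j : ℝ) * (3:ℝ) ^ (-n) * (3:ℝ) ^ (-m) = j * 3 ^ d * 3 := by
      rw [mul_assoc, ← zpow_add₀ (by norm_num), hd,
        show m + 1 + (d:ℤ) + -m = ((d + 1 : ℕ) : ℤ) by push_cast; ring, zpow_natCast]
      ring
    rw [e]; push_cast
    constructor <;> linarith
  rw [tdig_eq, this]; simp

lemma fin_supp (n : ℤ) (j : ℕ) (x : ℝ) :
    (Function.support fun m : ℤ => tdig m ((j : ℝ) * (3:ℝ) ^ (-n)) * tdig (-1 - m) x).Finite := by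
  apply (Set.finite_Icc (-n) (-n + j)).subset
  intro m hm
  rw [Function.mem_support] at hm
  by_contra hc
  apply hm
  rw [Set.mem_Icc, not_and_or, not_le, not_le] at hc
  rcases hc with hc | hc
  · rw [tdig_freq_low _ _ _ hc, zero_mul]
  · obtain ⟨d, hd⟩ : ∃ d : ℕ, m = -n + d := ⟨(m + n).toNat, by omega⟩
    have hj : j < d := by omega
    rw [hd, tdig_freq, Nat.div_eq_of_lt]
    · simp
    · exact hj.trans (Nat.lt_pow_self (by norm_num))

lemma wexp_rec (n : ℤ) (j k : ℕ) (x : ℝ) (hk : tdig (n - 1) x = k) :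
    wexp ((j : ℝ) * (3:ℝ) ^ (-n)) x =
      om3 ^ ((j % 3) * k) * wexp (((j / 3 : ℕ) : ℝ) * (3:ℝ) ^ (-(n - 1))) x := by
  unfold wexp
  rw [← pow_add]
  congr 1
  have hs : (∑ᶠ m : ℤ, if m = -n then (j % 3) * k else 0) = (j % 3) * k := by
    rw [finsum_eq_single _ (-n)]
    · simp
    · intro m hm; simp [hm]
  rw [← hs, ← finsum_add_distrib _ (fin_supp _ _ _)]
  · apply finsum_congr
    intro m
    rcases lt_trichotomy m (-n) with h | h | h
    · rw [tdig_freq_low _ _ _ h, tdig_freq_low _ _ _ (by omega), if_neg h.ne]; simp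
    · have h1 := tdig_freq n j 0
      rw [tdig_freq_low (n-1) _ _ (by omega), if_pos h, h]
      simp at h1
      rw [← zpow_neg] at h1
      rw [h1, show -1 - -n = n - 1 by ring, hk]; simp
    · obtain ⟨d, hd⟩ : ∃ d : ℕ, m = -n + (d + 1 : ℕ) := ⟨(m + n - 1).toNat, by omega⟩
      have h2 := tdig_freq (n-1) (j/3) d
      rw [show -(n-1) + (d:ℤ) = m by rw [hd]; push_cast; ring] at h2
      rw [if_neg h.ne', zero_add, h2]
      have h1 := tdig_freq n j (d+1)
      rw [← hd] at h1
      rw [h1, Nat.div_div_eq_div_mul, pow_succ']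
  · apply (Set.finite_singleton (-n)).subset
    intro m hm
    by_contra hc
    apply hm
    simp only [Set.mem_singleton_iff] at hc
    simp [hc]

lemma wexp_zero (n : ℤ) (x : ℝ) : wexp (((0 : ℕ) : ℝ) * (3:ℝ) ^ (-n)) x = 1 := by
  simp [wexp, tdig]

lemma om3_prim : IsPrimitiveRoot om3 3 := by
  have := Complex.isPrimitiveRoot_exp 3 (by norm_num)
  simpa [om3] using this

lemma om3_norm : ‖om3‖ = 1 := om3_prim.norm'_eq_one (by norm_num)

lemma wexp_norm (a x : ℝ) : ‖wexp a x‖ = 1 := by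
  simp [wexp, om3_norm]

def Tile.down (P : Tile) (k : Fin 3) : Tile := ⟨P.n - 1, 3 * P.i + k, P.j / 3⟩

lemma Tile.mem_I (P : Tile) (x : ℝ) : x ∈ P.I ↔ tfl P.n x = P.i := mem_tri _ _ _

lemma Tritile.mem_I (P : Tritile) (x : ℝ) : x ∈ P.I ↔ tfl P.n x = P.i := mem_tri _ _ _

lemma Tritile.mem_freqI (P : Tritile) (x : ℝ) : x ∈ P.freqI ↔ tfl (1 - P.n) x = P.j :=
  mem_tri _ _ _

lemma Tile.mem_down (P : Tile) (k : Fin 3) (x : ℝ) :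
    x ∈ (P.down k).I ↔ tfl (P.n - 1) x = 3 * P.i + k := by
  rw [Tile.mem_I]; simp [Tile.down]

lemma Tile.down_sub (P : Tile) (k : Fin 3) : (P.down k).I ⊆ P.I := by
  intro x hx
  rw [Tile.mem_down] at hx
  rw [Tile.mem_I, tfl_pred, hx]; omega

lemma Tile.exists_down (P : Tile) (x : ℝ) (hx : x ∈ P.I) : ∃ k, x ∈ (P.down k).I := by
  rw [Tile.mem_I, tfl_pred] at hx
  refine ⟨⟨(tfl (P.n - 1) x % 3).toNat, by omega⟩, ?_⟩
  rw [Tile.mem_down]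
  push_cast
  omega

lemma Tile.down_uniq (P : Tile) (x : ℝ) (k l : Fin 3) (hk : x ∈ (P.down k).I)
    (hl : x ∈ (P.down l).I) : k = l := by
  rw [Tile.mem_down] at hk hl
  ext; omega

lemma wp_out (P : Tile) (x : ℝ) (h : x ∉ P.I) : wp P x = 0 := by simp [wp, h]

lemma wp_on_down (P : Tile) (k : Fin 3) (x : ℝ) (hx : x ∈ (P.down k).I) :
    wp P x = (1 / 3) * om3 ^ ((P.j % 3) * (k : ℕ)) * wp (P.down k) x := by
  have h1 := P.down_sub k hx
  rw [wp, wp, if_pos h1, if_pos hx]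
  have hk : tdig (P.n - 1) x = k := by
    rw [Tile.mem_down] at hx
    rw [tdig_eq, hx]; omega
  have := wexp_rec P.n P.j k x hk
  unfold Tile.freq
  rw [this]
  simp only [Tile.down]
  have e : (3:ℂ) ^ (-(P.n - 1)) = 3 * (3:ℂ) ^ (-P.n) := by
    rw [neg_sub, sub_eq_add_neg 1, zpow_add₀ (by norm_num), zpow_one]
  rw [e]
  ring

lemma wp_split (P : Tile) (x : ℝ) :
    wp P x = ∑ k : Fin 3, (1 / 3) * om3 ^ ((P.j % 3) * (k : ℕ)) * wp (P.down k) x := by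
  by_cases hx : x ∈ P.I
  · obtain ⟨k, hk⟩ := P.exists_down x hx
    rw [Finset.sum_eq_single k, wp_on_down P k x hk]
    · intro l _ hl
      rw [wp_out (P.down l) x (fun h => hl (P.down_uniq x l k h hk))]; simp
    · simp
  · rw [wp_out _ _ hx, Finset.sum_eq_zero]
    intro k _
    rw [wp_out _ _ (fun h => hx (P.down_sub k h))]; simp

lemma om3_orth (k l : Fin 3) :
    ∑ u : Fin 3, om3⁻¹ ^ ((u : ℕ) * (l : ℕ)) * om3 ^ ((u : ℕ) * (k : ℕ)) = if k = l then 3 else 0 := by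
  have h3 : om3 ^ 3 = 1 := om3_prim.pow_eq_one
  have hs : 1 + om3 + om3 ^ 2 = 0 := by
    have := om3_prim.geom_sum_eq_zero (by norm_num)
    simpa [Finset.sum_range_succ] using this
  have hi : om3⁻¹ = om3 ^ 2 := by
    have h0 : om3 ≠ 0 := om3_prim.ne_zero (by norm_num)
    field_simp; exact h3.symm
  rw [hi]
  have h4 : om3 ^ 4 = om3 := by rw [pow_succ, h3, one_mul]
  have h5 : om3 ^ 5 = om3 ^ 2 := by rw [show 5 = 3 + 2 by rfl, pow_add, h3, one_mul]
  have h6 : om3 ^ 6 = 1 := by rw [show 6 = 3 * 2 by rfl, pow_mul, h3, one_pow]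
  have h8 : om3 ^ 8 = om3 ^ 2 := by rw [show 8 = 6 + 2 by rfl, pow_add, h6, one_mul]
  have h10 : om3 ^ 10 = om3 := by rw [show 10 = 6 + 4 by rfl, pow_add, h6, one_mul, h4]
  have h12 : om3 ^ 12 = 1 := by rw [show 12 = 6 * 2 by rfl, pow_mul, h6, one_pow]
  fin_cases k <;> fin_cases l <;> simp [Fin.sum_univ_three, ← pow_mul, ← pow_add, h3, h4, h5, h6, h8, h10, h12] <;>
    first | linear_combination hs | norm_num

lemma Tritile.sub_down (P : Tritile) (u k : Fin 3) :
    (P.sub u).down k = ⟨P.n - 1, 3 * P.i + k, P.j⟩ := by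
  simp only [Tritile.sub, Tile.down]; congr 1; omega

lemma Tritile.sub_mod (P : Tritile) (u : Fin 3) : (P.sub u).j % 3 = u := by
  simp only [Tritile.sub]; omega

/-- The child tile with the frequency of the tritile. -/
def Tritile.kid (P : Tritile) (k : Fin 3) : Tile := ⟨P.n - 1, 3 * P.i + k, P.j⟩

lemma wp_kid (P : Tritile) (u : Fin 3) (x : ℝ) :
    wp (P.sub u) x = ∑ k : Fin 3, (1 / 3) * om3 ^ ((u : ℕ) * (k : ℕ)) * wp (P.kid k) x := by
  rw [wp_split, Tritile.sub_mod]
  simp only [Tritile.sub_down]; rfl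

lemma wp_kid_inv (P : Tritile) (l : Fin 3) (x : ℝ) :
    wp (P.kid l) x = ∑ u : Fin 3, om3⁻¹ ^ ((u : ℕ) * (l : ℕ)) * wp (P.sub u) x := by
  simp only [wp_kid, Finset.mul_sum]
  rw [Finset.sum_comm]
  have : ∀ k : Fin 3, ∑ u : Fin 3, om3⁻¹ ^ ((u : ℕ) * (l : ℕ)) *
      ((1 / 3) * om3 ^ ((u : ℕ) * (k : ℕ)) * wp (P.kid k) x) =
      if k = l then wp (P.kid k) x else 0 := by
    intro k
    have h := om3_orth k l
    calc _ = (1/3) * wp (P.kid k) x * ∑ u : Fin 3, om3⁻¹ ^ ((u : ℕ) * (l : ℕ)) * om3 ^ ((u : ℕ) * (k : ℕ)) := by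
          rw [Finset.mul_sum]; apply Finset.sum_congr rfl; intros; ring
      _ = _ := by rw [h]; split_ifs <;> ring
  simp only [this]; simp

/-! Walsh Schwartz functions -/

lemma ws_iff {X : Type*} [NormedAddCommGroup X] (f : ℝ → X) : WalshSchwartz f ↔
    ∃ N : ℕ, (∀ x, f x ≠ 0 → 0 ≤ x ∧ tfl N x = 0) ∧
      ∀ x y, 0 ≤ x → 0 ≤ y → tfl (-N) x = tfl (-N) y → f x = f y := by
  unfold WalshSchwartz
  apply exists_congr
  intro N
  apply and_congr
  · apply forall_congr'
    intro x
    have := mem_tri N 0 x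
    simp only [Nat.cast_zero, zero_mul, zero_add, one_mul] at this
    rw [this]
    constructor
    · intro h h2
      have h3 : tfl N x = 0 := by by_contra hc; exact h2 (h hc)
      exact ⟨(this.2 h3).1, h3⟩
    · intro h h2; by_contra hc; exact h2 (h hc).2
  · constructor
    · intro h x y hx hy hxy
      have h0 : 0 ≤ tfl (-N) x := Int.floor_nonneg.2 (by positivity)
      refine h (tfl (-N) x).toNat x ?_ y ?_ <;> rw [mem_tri] <;> omega
    · intro h k x hx y hy
      have hx0 : 0 ≤ x := le_trans (by positivity) hx.1
      have hy0 : 0 ≤ y := le_trans (by positivity) hy.1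
      rw [mem_tri] at hx hy
      exact h x y hx0 hy0 (hx.trans hy.symm)

lemma ws_ev {X : Type*} [NormedAddCommGroup X] {f : ℝ → X} (hf : WalshSchwartz f) :
    ∃ N : ℕ, ∀ M : ℕ, N ≤ M → (∀ x, f x ≠ 0 → 0 ≤ x ∧ tfl M x = 0) ∧
      ∀ x y, 0 ≤ x → 0 ≤ y → tfl (-M) x = tfl (-M) y → f x = f y := by
  obtain ⟨N, h1, h2⟩ := (ws_iff f).1 hf
  refine ⟨N, fun M hM => ?_⟩
  obtain ⟨d, rfl⟩ := Nat.exists_eq_add_of_le hM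
  constructor
  · intro x hx
    refine ⟨(h1 x hx).1, ?_⟩
    push_cast
    rw [tfl_add, (h1 x hx).2]; simp
  · intro x y hx hy h
    apply h2 x y hx hy
    have e : -(N:ℤ) = -((N + d : ℕ) : ℤ) + d := by push_cast; ring
    rw [e, tfl_add, tfl_add, h]

/-- Pointwise combination of Schwartz functions. -/
lemma ws_map2 {X Y Z : Type*} [NormedAddCommGroup X] [NormedAddCommGroup Y] [NormedAddCommGroup Z]
    {f : ℝ → X} {g : ℝ → Y} (hf : WalshSchwartz f) (hg : WalshSchwartz g) (F : X → Y → Z)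
    (hF : F 0 0 = 0) : WalshSchwartz fun x => F (f x) (g x) := by
  obtain ⟨N, hN⟩ := ws_ev hf
  obtain ⟨M, hM⟩ := ws_ev hg
  obtain ⟨a, b⟩ := hN (max N M) (le_max_left _ _)
  obtain ⟨c, d⟩ := hM (max N M) (le_max_right _ _)
  rw [ws_iff]
  refine ⟨max N M, ?_, ?_⟩
  · intro x hx
    by_cases h1 : f x = 0
    · by_cases h2 : g x = 0
      · simp [h1, h2, hF] at hx
      · exact c x h2
    · exact a x h1
  · intro x y hx hy h
    simp only [b x y hx hy h, d x y hx hy h]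

lemma ws_map {X Z : Type*} [NormedAddCommGroup X] [NormedAddCommGroup Z]
    {f : ℝ → X} (hf : WalshSchwartz f) (F : X → Z)
    (hF : F 0 = 0) : WalshSchwartz fun x => F (f x) :=
  ws_map2 hf hf (fun a _ => F a) hF

lemma ws_zero {X : Type*} [NormedAddCommGroup X] : WalshSchwartz (fun _ : ℝ => (0 : X)) :=
  ⟨0, by simp, by simp⟩

lemma ws_sum {X ι : Type*} [NormedAddCommGroup X] (s : Finset ι) {f : ι → ℝ → X}
    (hf : ∀ i, WalshSchwartz (f i)) : WalshSchwartz fun x => ∑ i ∈ s, f i x := by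
  induction s using Finset.induction_on with
  | empty => simpa using ws_zero
  | insert a s ha ih =>
    simp only [Finset.sum_insert ha]
    exact ws_map2 (hf a) ih (fun a b => a + b) (by simp)

lemma ws_wp (P : Tile) : WalshSchwartz (wp P) := by
  obtain ⟨n, i, j⟩ := P
  induction j using Nat.strong_induction_on generalizing n i with
  | _ j ih =>
    by_cases hj : j = 0
    · subst hj
      rw [ws_iff]
      refine ⟨n.natAbs + i, ?_, ?_⟩
      · intro x hx
        have hm : x ∈ (Tile.mk n i 0).I := by by_contra hc; exact hx (wp_out _ _ hc)
        refine ⟨le_trans (by positivity) hm.1, ?_⟩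
        rw [Tile.mem_I] at hm
        simp only at hm
        obtain ⟨d, hd⟩ : ∃ d : ℕ, ((n.natAbs + i : ℕ) : ℤ) = n + d :=
          ⟨(n.natAbs + i - n).toNat, by omega⟩
        rw [hd, tfl_add, hm]
        apply Int.ediv_eq_zero_of_lt (by positivity)
        have : i < 3 ^ d := lt_of_le_of_lt (show i ≤ d by omega) (Nat.lt_pow_self (by norm_num))
        exact_mod_cast this
      · intro x y hx hy h
        have hxy : x ∈ (Tile.mk n i 0).I ↔ y ∈ (Tile.mk n i 0).I := by
          obtain ⟨d, hd⟩ : ∃ d : ℕ, n = -((n.natAbs + i : ℕ) : ℤ) + d :=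
            ⟨(n.natAbs + i + n).toNat, by omega⟩
          rw [Tile.mem_I, Tile.mem_I]
          simp only
          rw [hd, tfl_add, tfl_add]
          rw [h]
        simp only [wp, hxy, Tile.freq, wexp_zero]
    · have : wp ⟨n, i, j⟩ = fun x => ∑ k : Fin 3, (1 / 3) * om3 ^ ((j % 3) * (k : ℕ)) *
          wp ((Tile.mk n i j).down k) x := by
        funext x; exact wp_split _ x
      rw [this]
      apply ws_sum
      intro k
      exact ws_map (ih (j / 3) (by omega) _ _) (fun z => (1 / 3) * om3 ^ ((j % 3) * (k : ℕ)) * z) (by simp)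

lemma ws_int {X : Type*} [NormedAddCommGroup X] {f : ℝ → X} (hf : WalshSchwartz f) :
    Integrable f := by
  obtain ⟨N, h1, h2⟩ := (ws_iff f).1 hf
  have hN : (0:ℝ) < (3:ℝ) ^ N := by positivity
  set h : ℤ → X := fun k => f (k * (3:ℝ) ^ (-(N:ℤ))) with hh
  have key : ∀ x, 0 ≤ x → f x = h (tfl (-N) x) := by
    intro x hx
    have h0 : 0 ≤ tfl (-N) x := Int.floor_nonneg.2 (by positivity)
    apply h2 x _ hx (by positivity)
    have := tfl_freq N (tfl (-N) x).toNat 0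
    have e : (((tfl (-N) x).toNat : ℕ) : ℝ) = ((tfl (-N) x : ℤ) : ℝ) := by
      exact_mod_cast Int.toNat_of_nonneg h0
    rw [e] at this
    simp only [Nat.cast_zero, add_zero, pow_zero, Nat.div_one] at this
    rw [this]; omega
  set s := Set.Ico (0:ℝ) ((3:ℝ) ^ N)
  have hs : ∀ x, x ∈ s ↔ tfl N x = 0 := by
    intro x
    have := mem_tri N 0 x
    simpa [s] using this
  have hsup : Function.support f ⊆ s := fun x hx => (hs x).2 (h1 x hx).2
  rw [← integrableOn_iff_integrable_of_support_subset hsup]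
  have hmeas : Measurable (tfl (-N)) := by
    unfold tfl; exact (measurable_id.mul_const _).floor
  have hsm : StronglyMeasurable (fun x => h (tfl (-N) x)) :=
    (StronglyMeasurable.of_discrete (f := h)).comp_measurable hmeas
  have hio : IntegrableOn (fun x => h (tfl (-N) x)) s := by
    apply Measure.integrableOn_of_bounded (M := ∑ k ∈ Finset.Icc (0:ℤ) (3 ^ (2 * N)), ‖h k‖)
    · simp [s]
    · exact hsm.aestronglyMeasurable
    · rw [ae_restrict_iff' measurableSet_Ico]
      refine Filter.Eventually.of_forall fun x hx => ?_
      apply Finset.single_le_sum (f := fun k => ‖h k‖) (fun _ _ => norm_nonneg _)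
      rw [Finset.mem_Icc]
      have hx0 : 0 ≤ x := hx.1
      have h0 : 0 ≤ tfl (-N) x := Int.floor_nonneg.2 (by positivity)
      refine ⟨h0, ?_⟩
      have e := (hs x).1 hx
      rw [show (N:ℤ) = -(N:ℤ) + ((2 * N : ℕ) : ℤ) by push_cast; ring, tfl_add] at e
      by_contra hc
      push Not at hc
      have := (Int.le_ediv_iff_mul_le (show (0:ℤ) < 3 ^ (2 * N) by positivity)).2 (show 1 * 3 ^ (2*N) ≤ tfl (-N) x by omega)
      omega
  exact hio.congr_fun (fun x hx => (key x hx.1).symm) measurableSet_Ico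

def Tritile.child (P : Tritile) (k : Fin 3) : Tritile := ⟨P.n - 1, 3 * P.i + k, P.j / 3⟩

lemma Tritile.mem_child (P : Tritile) (k : Fin 3) (x : ℝ) :
    x ∈ (P.child k).I ↔ tfl (P.n - 1) x = 3 * P.i + k := by
  rw [Tritile.mem_I]; simp [Tritile.child]

lemma Tritile.child_uniq (P : Tritile) (x : ℝ) (k l : Fin 3) (hk : x ∈ (P.child k).I)
    (hl : x ∈ (P.child l).I) : k = l := by
  rw [Tritile.mem_child] at hk hl
  ext; omega

lemma Tritile.kid_eq (P : Tritile) (k : Fin 3) :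
    P.kid k = (P.child k).sub ⟨P.j % 3, Nat.mod_lt _ (by norm_num)⟩ := by
  simp only [Tritile.kid, Tritile.child, Tritile.sub]; congr 1; omega

lemma child_tle (P : Tritile) (k : Fin 3) : tle (P.child k) P := by
  constructor
  · intro x hx
    rw [Tritile.mem_child] at hx
    rw [Tritile.mem_I, tfl_pred, hx]; omega
  · intro x hx
    rw [Tritile.mem_freqI] at hx ⊢
    have := tfl_pred (1 - (P.child k).n) x
    rw [this, show (1 - (P.child k).n) - 1 = 1 - P.n by simp only [Tritile.child]; ring, hx]
    simp [Tritile.child]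

lemma tle_trans {P Q R : Tritile} (h : tle P Q) (h' : tle Q R) : tle P R :=
  ⟨h.1.trans h'.1, h'.2.trans h.2⟩

lemma left_mem (P : Tritile) : (P.i : ℝ) * (3:ℝ) ^ P.n ∈ P.I := by
  have h3 : (0:ℝ) < (3:ℝ) ^ P.n := by positivity
  exact ⟨le_rfl, by nlinarith⟩

lemma left_mem_freq (P : Tritile) : (P.j : ℝ) * (3:ℝ) ^ (1 - P.n) ∈ P.freqI := by
  have h3 : (0:ℝ) < (3:ℝ) ^ (1 - P.n) := by positivity
  exact ⟨le_rfl, by nlinarith⟩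

lemma tle_n {Q P : Tritile} (h : tle Q P) : Q.n ≤ P.n := by
  have h3 : (0:ℝ) < (3:ℝ) ^ Q.n := by positivity
  have := (Set.Ico_subset_Ico_iff (show (Q.i : ℝ) * (3:ℝ) ^ Q.n < ((Q.i : ℝ) + 1) * (3:ℝ) ^ Q.n by nlinarith)).1 h.1
  have h4 : (3:ℝ) ^ Q.n ≤ (3:ℝ) ^ P.n := by nlinarith [this.1, this.2]
  exact (zpow_le_zpow_iff_right₀ (by norm_num)).1 h4

lemma tle_cases {Q P : Tritile} (h : tle Q P) : Q = P ∨ ∃ k, tle Q (P.child k) := by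
  have hn := tle_n h
  have hx := h.1 (left_mem Q)
  have hy := h.2 (left_mem_freq P)
  have hx' := left_mem Q
  have hy' := left_mem_freq P
  set x := (Q.i : ℝ) * (3:ℝ) ^ Q.n
  set y := (P.j : ℝ) * (3:ℝ) ^ (1 - P.n)
  rw [Tritile.mem_I] at hx hx'
  rw [Tritile.mem_freqI] at hy hy'
  rcases hn.eq_or_lt with hn | hn
  · left
    rw [hn] at hx' hy
    obtain ⟨a, b, c⟩ := P
    obtain ⟨a', b', c'⟩ := Q
    simp only at *
    subst hn
    congr 1 <;> omega
  · right
    obtain ⟨d, hd⟩ : ∃ d : ℕ, P.n - 1 = Q.n + d := ⟨(P.n - 1 - Q.n).toNat, by omega⟩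
    rw [tfl_pred] at hx
    refine ⟨⟨(tfl (P.n - 1) x % 3).toNat, by omega⟩, ?_, ?_⟩
    · intro z hz
      rw [Tritile.mem_I] at hz
      rw [Tritile.mem_child]
      have e : tfl (P.n - 1) z = tfl (P.n - 1) x := by
        rw [hd, tfl_add, tfl_add, hz, hx']
      rw [e]; push_cast; omega
    · intro z hz
      rw [Tritile.mem_freqI] at hz ⊢
      simp only [Tritile.child] at hz
      have e1 : 1 - Q.n = 1 - (P.n - 1) + d := by omega
      rw [e1, tfl_add] at hy ⊢
      rw [tfl_pred, show 1 - (P.n - 1) - 1 = 1 - P.n by ring, hy'] at hy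
      rw [hz, ← hy]; push_cast; rfl

section
variable {X : Type*} [NormedAddCommGroup X] [NormedSpace ℂ X]

lemma emb_congr {f g : ℝ → X} {T : Tile} (h : ∀ x ∈ T.I, f x = g x) : emb f T = emb g T := by
  unfold emb
  congr 1
  funext x
  by_cases hx : x ∈ T.I
  · rw [h x hx]
  · rw [wp_out _ _ hx, zero_smul, zero_smul]

lemma emb_integrable {f : ℝ → X} (hf : WalshSchwartz f) (T : Tile) :
    Integrable (fun x => wp T x • f x) :=
  ws_int (ws_map2 (ws_wp T) hf (fun a b => a • b) (by simp))

lemma emb_lin {f : ℝ → X} (hf : WalshSchwartz f) (T : Tile) (S : Fin 3 → Tile) (c : Fin 3 → ℂ)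
    (h : ∀ x, wp T x = ∑ k, c k * wp (S k) x) : emb f T = ∑ k, c k • emb f (S k) := by
  unfold emb
  simp only [h, Finset.sum_smul, mul_smul]
  rw [integral_finsetSum]
  · simp only [integral_smul]
  · intro k _
    exact (emb_integrable hf (S k)).smul (c k)

lemma emb_sub {f : ℝ → X} (hf : WalshSchwartz f) (P : Tritile) (u : Fin 3) :
    emb f (P.sub u) = ∑ k : Fin 3, ((1 / 3) * om3 ^ ((u : ℕ) * (k : ℕ))) • emb f (P.kid k) :=
  emb_lin hf _ _ _ (wp_kid P u)

lemma emb_kid {f : ℝ → X} (hf : WalshSchwartz f) (P : Tritile) (k : Fin 3) :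
    emb f (P.kid k) = ∑ u : Fin 3, (om3⁻¹ ^ ((u : ℕ) * (k : ℕ))) • emb f (P.sub u) :=
  emb_lin hf _ _ _ (wp_kid_inv P k)

lemma emb_kid_bound {f : ℝ → X} (hf : WalshSchwartz f) (P : Tritile) (k : Fin 3) (S : ℝ)
    (hS : ∀ u, ‖emb f (P.sub u)‖ ≤ S) : ‖emb f (P.kid k)‖ ≤ 3 * S := by
  rw [emb_kid hf]
  refine (norm_sum_le _ _).trans ?_
  simp only [norm_smul, norm_pow, norm_inv, om3_norm, inv_one, one_pow, one_mul]
  rw [Fin.sum_univ_three]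
  linarith [hS 0, hS 1, hS 2]

/-- The basic building block. -/
def blk (T : Tile) (v : X) : ℝ → X := fun x => ((3:ℂ) ^ T.n * (starRingEnd ℂ) (wp T x)) • v

lemma blk_ws (T : Tile) (v : X) : WalshSchwartz (blk T v) :=
  ws_map (ws_wp T) (fun z => ((3:ℂ) ^ T.n * (starRingEnd ℂ) z) • v) (by simp)

lemma blk_out (T : Tile) (v : X) (x : ℝ) (h : x ∉ T.I) : blk T v x = 0 := by
  simp [blk, wp_out _ _ h]

lemma blk_norm (T : Tile) (v : X) (x : ℝ) : ‖blk T v x‖ ≤ ‖v‖ := by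
  by_cases h : x ∈ T.I
  · rw [blk, wp, if_pos h, norm_smul, norm_mul, RCLike.norm_conj, norm_mul, wexp_norm]
    rw [norm_zpow, norm_zpow, mul_one, ← zpow_add₀ (by norm_num)]
    simp
  · rw [blk_out _ _ _ h]; simp

lemma blk_emb [CompleteSpace X] (T : Tile) (v : X) : emb (blk T v) T = v := by
  have h3 : (0:ℝ) < (3:ℝ) ^ T.n := by positivity
  have : (fun x => wp T x • blk T v x) = T.I.indicator fun _ => ((3:ℝ) ^ (-T.n)) • v := by
    funext x
    by_cases h : x ∈ T.I
    · rw [Set.indicator_of_mem h, blk, wp, if_pos h, smul_smul]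
      have hw : wexp T.freq x * (starRingEnd ℂ) (wexp T.freq x) = 1 := by
        rw [Complex.mul_conj, Complex.normSq_eq_norm_sq, wexp_norm]; simp
      have h33 : (3:ℂ) ^ (-T.n) * 3 ^ T.n = 1 := by
        rw [← zpow_add₀ (by norm_num)]; simp
      have hc : (starRingEnd ℂ) ((3:ℂ) ^ (-T.n)) = (3:ℂ) ^ (-T.n) := by
        rw [map_zpow₀, Complex.conj_ofNat]
      rw [map_mul, hc]
      have e : (3:ℂ) ^ (-T.n) * wexp T.freq x *
          (3 ^ T.n * (3 ^ (-T.n) * (starRingEnd ℂ) (wexp T.freq x))) = ((3:ℝ) ^ (-T.n) : ℝ) := by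
        push_cast
        calc _ = ((3:ℂ) ^ (-T.n) * 3 ^ T.n) * (wexp T.freq x * (starRingEnd ℂ) (wexp T.freq x)) *
              3 ^ (-T.n) := by ring
          _ = _ := by rw [hw, h33]; ring
      rw [e, Complex.coe_smul]
    · rw [Set.indicator_of_notMem h, wp_out _ _ h, zero_smul]
  unfold emb
  rw [this, integral_indicator (by unfold Tile.I; exact measurableSet_Ico), setIntegral_const,
    Tile.I, Real.volume_real_Ico_of_le (by nlinarith), smul_smul]
  have : (((T.i : ℝ) + 1) * 3 ^ T.n - T.i * 3 ^ T.n) * 3 ^ (-T.n) = (1:ℝ) := by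
    rw [zpow_neg]; field_simp; ring
  rw [this, one_smul]

lemma proj_step [CompleteSpace X] {f : ℝ → X} (hf : WalshSchwartz f) (A : Finset Tritile)
    (hA : TriConvex (↑A : Set Tritile)) (S : ℝ) (b : ℤ) (hb : ∀ P ∈ A, b ≤ P.n) (hS0 : 0 ≤ S)
    (m : ℕ) : ∀ P ∈ A, P.n < b + m → (∀ Q ∈ tree P, Q ∈ A → ∀ u, ‖emb f (Q.sub u)‖ ≤ S) →
      ∃ g : ℝ → X, WalshSchwartz g ∧ (∀ x : ℝ, x ∉ P.I → g x = 0) ∧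
        (∀ Q ∈ tree P, Q ∈ A → ∀ u : Fin 3, emb g (Q.sub u) = emb f (Q.sub u)) ∧
        ∀ x, ‖g x‖ ≤ 3 * S := by
  induction m with
  | zero => intro P hP h; have := hb P hP; simp at h; omega
  | succ m ih =>
    intro P hP hm hS
    have hPP : P ∈ tree P := ⟨subset_rfl, subset_rfl⟩
    have hk : ∀ k : Fin 3, ∃ g : ℝ → X, WalshSchwartz g ∧ (∀ x : ℝ, x ∉ (P.child k).I → g x = 0) ∧
        (∀ Q ∈ tree (P.child k), Q ∈ A → ∀ u : Fin 3, emb g (Q.sub u) = emb f (Q.sub u)) ∧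
        (∀ x, ‖g x‖ ≤ 3 * S) ∧ emb g (P.kid k) = emb f (P.kid k) := by
      intro k
      by_cases hc : P.child k ∈ A
      · obtain ⟨g, h1, h2, h3, h4⟩ := ih (P.child k) hc
          (by simp only [Tritile.child]; push_cast at hm; omega)
          (fun Q hQ => hS Q (tle_trans hQ (child_tle P k)))
        refine ⟨g, h1, h2, h3, h4, ?_⟩
        rw [Tritile.kid_eq]
        exact h3 _ ⟨subset_rfl, subset_rfl⟩ hc _
      · refine ⟨blk (P.kid k) (emb f (P.kid k)), blk_ws _ _, fun x hx => blk_out _ _ _ hx, ?_, ?_,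
          blk_emb _ _⟩
        · intro Q hQ hQA
          exact absurd (hA Q P (P.child k) hQA hP hQ (child_tle P k)) hc
        · intro x
          exact (blk_norm _ _ _).trans (emb_kid_bound hf P k S (hS P hPP hP))
    choose g h1 h2 h3 h4 h5 using hk
    have hg : WalshSchwartz fun x => ∑ k, g k x := ws_sum _ h1
    have hon : ∀ k, ∀ x ∈ (P.child k).I, ∑ l, g l x = g k x := by
      intro k x hx
      apply Finset.sum_eq_single k
      · intro l _ hl
        exact h2 l x fun h => hl (P.child_uniq x l k h hx)
      · simp
    refine ⟨fun x => ∑ k, g k x, hg, ?_, ?_, ?_⟩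
    · intro x hx
      exact Finset.sum_eq_zero fun k _ => h2 k x fun h => hx ((child_tle P k).1 h)
    · intro Q hQ hQA u
      rcases tle_cases hQ with rfl | ⟨k, hk⟩
      · rw [emb_sub hg, emb_sub hf]
        apply Finset.sum_congr rfl
        intro k _
        rw [← h5 k, emb_congr (f := fun x => ∑ k, g k x) (g := g k) (T := Q.kid k) (hon k)]
      · rw [← h3 k Q hk hQA u]
        exact emb_congr fun x hx => hon k x (hk.1 hx)
    · intro x
      by_cases hx : ∃ k, x ∈ (P.child k).I
      · obtain ⟨k, hk⟩ := hx
        simp only [hon k x hk]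
        exact h4 k x
      · push Not at hx
        simp only [fun k => h2 k x (hx k)]
        simp [hS0]

end

/-- Convex projection lemma: there is an absolute constant `C` such
that for every Banach space `X`, Schwartz `f : 𝕎 → X`, tree `T` with top `𝐏_T`, and
finite convex set `A` of tritiles with `𝐏_T ∈ A`, there is a Schwartz function `g`
supported on `I_T` whose wave packet coefficients agree with those of `f` on `T ∩ A`,
with `‖g‖_{L^∞} ≤ C sup_{𝐏 ∈ T ∩ A, u} ‖⟨f; w_{𝐏_u}⟩‖`. -/
theorem stmt19 :
    ∃ C : ℝ, 0 < C ∧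
      ∀ (X : Type) [NormedAddCommGroup X] [NormedSpace ℂ X] [CompleteSpace X]
        (f : ℝ → X), WalshSchwartz f →
        ∀ (Ttop : Tritile) (A : Finset Tritile),
          TriConvex (↑A : Set Tritile) → Ttop ∈ A →
          ∃ g : ℝ → X, WalshSchwartz g ∧ (∀ x : ℝ, x ∉ Ttop.I → g x = 0) ∧
            (∀ P ∈ tree Ttop, P ∈ A → ∀ u : Fin 3, emb g (P.sub u) = emb f (P.sub u)) ∧
            (∀ x : ℝ, ‖g x‖ ≤ C * sSup ((fun q : Tritile × Fin 3 => ‖emb f (q.1.sub q.2)‖) ''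
              {q : Tritile × Fin 3 | q.1 ∈ tree Ttop ∧ q.1 ∈ A})) := by
  refine ⟨3, by norm_num, ?_⟩
  intro X _ _ _ f hf Ttop A hA hT
  set S := sSup ((fun q : Tritile × Fin 3 => ‖emb f (q.1.sub q.2)‖) ''
              {q : Tritile × Fin 3 | q.1 ∈ tree Ttop ∧ q.1 ∈ A}) with hSdef
  have hfin : ((fun q : Tritile × Fin 3 => ‖emb f (q.1.sub q.2)‖) ''
              {q : Tritile × Fin 3 | q.1 ∈ tree Ttop ∧ q.1 ∈ A}).Finite := by
    apply Set.Finite.image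
    apply ((A.finite_toSet).prod (Set.finite_univ (α := Fin 3))).subset
    intro q hq
    exact ⟨hq.2, Set.mem_univ _⟩
  have hS : ∀ Q ∈ tree Ttop, Q ∈ A → ∀ u, ‖emb f (Q.sub u)‖ ≤ S := by
    intro Q hQ hQA u
    exact le_csSup hfin.bddAbove ⟨(Q, u), ⟨hQ, hQA⟩, rfl⟩
  have hS0 : 0 ≤ S := by
    apply Real.sSup_nonneg
    rintro _ ⟨q, _, rfl⟩
    exact norm_nonneg _
  obtain ⟨b, hb⟩ := (A.image Tritile.n).finite_toSet.bddBelow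
  have hb' : ∀ P ∈ A, b ≤ P.n := fun P hP => hb (by
    rw [Finset.mem_coe]; exact Finset.mem_image_of_mem _ hP)
  have hTb := hb' _ hT
  exact proj_step hf A hA S b hb' hS0 ((Ttop.n - b).toNat + 1) Ttop hT (by push_cast; omega) hS
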